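/- arXiv:2007.02098 — 4 statements merged into one kernel-verified Lean document; each statement's English description precedes it below -/
import Mathlib

section
/- For every real λ > -1, every μ ∈ ℂ, and every z ∈ ℂ, the series ∑_{n=0}^∞ z^n/(n!·Γ(λn+μ)) converges absolutely; moreover the function z ↦ ∑_{n=0}^∞ z^n/(n!·Γ(λn+μ)) is differentiable (hence entire) on all of ℂ. -/
/-- The Wright function `W_{λ,μ}(z) = ∑ zⁿ/(n!·Γ(λn+μ))`, with the convention
`1/Γ(w) = 0` at poles of `Γ` (Mathlib's `Complex.Gamma` vanishes at the poles). -/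
noncomputable def wrightC (l : ℝ) (μ : ℂ) (z : ℂ) : ℂ :=
  ∑' n : ℕ, z ^ n / ((n.factorial : ℂ) * Complex.Gamma (((l * n : ℝ) : ℂ) + μ))

/-- The reciprocal Gamma function is bounded on the part of a horizontal strip with `1 ≤ re s`. -/
theorem exists_norm_inv_Gamma_le_of_one_le_re (c : ℝ) :
    ∃ M : ℝ, ∀ s : ℂ, |s.im| ≤ c → 1 ≤ s.re → ‖(Complex.Gamma s)⁻¹‖ ≤ M := by
  have hK : IsCompact (Set.Icc (1 : ℝ) 2 ×ℂ Set.Icc (-c) c) := isCompact_Icc.reProdIm isCompact_Icc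
  obtain ⟨M, hM⟩ := hK.exists_bound_of_continuousOn
    Complex.differentiable_one_div_Gamma.continuous.continuousOn
  refine ⟨M, ?_⟩
  have key : ∀ j : ℕ, ∀ s : ℂ, |s.im| ≤ c → 1 ≤ s.re → s.re ≤ j + 2 →
      ‖(Complex.Gamma s)⁻¹‖ ≤ M := by
    intro j
    induction j with
    | zero =>
      intro s hs h1 h2
      exact hM s ⟨⟨h1, by simpa using h2⟩, abs_le.mp hs⟩
    | succ j ih =>
      intro s hs h1 h2
      push_cast at h2
      by_cases h : s.re ≤ j + 2
      · exact ih s hs h1 h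
      have hj : (0 : ℝ) ≤ j := j.cast_nonneg
      have hn : 1 ≤ ‖s - 1‖ := by
        refine le_trans ?_ (Complex.re_le_norm _)
        simp only [Complex.sub_re, Complex.one_re]
        linarith
      have ihs := ih (s - 1) (by simpa using hs)
        (by simp only [Complex.sub_re, Complex.one_re]; linarith)
        (by simp only [Complex.sub_re, Complex.one_re]; linarith)
      rw [Complex.one_div_Gamma_eq_self_mul_one_div_Gamma_add_one, sub_add_cancel, norm_mul] at ihs
      exact (le_mul_of_one_le_left (norm_nonneg _) hn).trans ihs
  intro s hs h1
  obtain ⟨j, hj⟩ := exists_nat_ge s.re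
  exact key j s hs h1 (by linarith)

/-- On a horizontal strip, the reciprocal Gamma function grows at most factorially to the left. -/
theorem exists_norm_inv_Gamma_le_mul_factorial (c : ℝ) :
    ∃ (M : ℝ) (N : ℕ), 0 ≤ M ∧ ∀ (k : ℕ) (s : ℂ), |s.im| ≤ c → 1 - k ≤ s.re →
      ‖(Complex.Gamma s)⁻¹‖ ≤ M * (k + N).factorial := by
  obtain ⟨M, hM⟩ := exists_norm_inv_Gamma_le_of_one_le_re c
  obtain ⟨N, hN⟩ := exists_nat_ge c
  refine ⟨max M 0, N, le_max_right _ _, fun k ↦ ?_⟩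
  induction k with
  | zero =>
    intro s hs h1
    refine (hM s hs (by simpa using h1)).trans ((le_max_left M 0).trans ?_)
    exact le_mul_of_one_le_right (le_max_right _ _) (mod_cast Nat.one_le_of_lt (Nat.factorial_pos _))
  | succ k ih =>
    intro s hs h1
    push_cast at h1
    by_cases h : 1 - k ≤ s.re
    · refine (ih s hs h).trans ?_
      gcongr
      omega
    have hk : (0 : ℝ) ≤ k := k.cast_nonneg
    have hre : |s.re| ≤ k + 1 := abs_le.mpr ⟨by linarith, by linarith⟩
    have hn : ‖s‖ ≤ k + N + 1 := by linarith [Complex.norm_le_abs_re_add_abs_im s]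
    have ihs := ih (s + 1) (by simpa using hs)
      (by simp only [Complex.add_re, Complex.one_re]; linarith)
    rw [Complex.one_div_Gamma_eq_self_mul_one_div_Gamma_add_one, norm_mul, Nat.add_right_comm,
      Nat.factorial_succ]
    calc ‖s‖ * ‖(Complex.Gamma (s + 1))⁻¹‖
        ≤ (k + N + 1) * (max M 0 * (k + N).factorial) := by gcongr
      _ = _ := by push_cast; ring

/-- If `m n ≤ a * n + C` with `a < 1`, then `m n ! / n !` decays faster than any geometric
sequence. -/
theorem exists_pow_mul_factorial_div_factorial_le {a : ℝ} (ha : a < 1) (C : ℝ) {m : ℕ → ℕ}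
    (hm : ∀ n, (m n : ℝ) ≤ a * n + C) {r : ℝ} (hr : 1 ≤ r) :
    ∃ B : ℝ, ∀ᶠ n : ℕ in Filter.atTop,
      r ^ n * ((m n).factorial / n.factorial) ≤ B := by
  obtain ⟨p, hp⟩ := exists_nat_ge (1 / (1 - a))
  rw [div_le_iff₀ (by linarith)] at hp
  obtain ⟨q, hq⟩ := exists_nat_ge C
  refine ⟨r ^ (p * q) * Real.exp (r ^ p), ?_⟩
  filter_upwards [Filter.eventually_ge_atTop (p * q)] with n hn
  have hn' : (p : ℝ) * q ≤ n := mod_cast hn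
  have hn0 : (0 : ℝ) ≤ n := n.cast_nonneg
  have hp0 : (0 : ℝ) < p := by
    rcases p.eq_zero_or_pos with rfl | h
    · norm_num at hp
    · exact_mod_cast h
  have hpn : (n : ℝ) ≤ p * (1 - a) * n := le_mul_of_one_le_left hn0 hp
  have hmn : m n ≤ n := by
    have : (p : ℝ) * m n ≤ p * n := by nlinarith [hm n]
    exact_mod_cast le_of_mul_le_mul_left this hp0
  obtain ⟨d, hd⟩ := Nat.exists_eq_add_of_le hmn
  have hd' : (n : ℝ) = m n + d := mod_cast hd
  have hnd : n ≤ p * q + p * d := by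
    have : (n : ℝ) ≤ p * q + p * d := by nlinarith [hm n]
    exact_mod_cast this
  have hfac : ((m n).factorial : ℝ) / n.factorial ≤ 1 / d.factorial := by
    rw [div_le_div_iff₀ (by positivity) (by positivity), one_mul]
    have := Nat.le_of_dvd (Nat.factorial_pos _) (Nat.factorial_mul_factorial_dvd_factorial_add (m n) d)
    rw [← hd] at this
    exact_mod_cast this
  calc r ^ n * ((m n).factorial / n.factorial)
      ≤ r ^ (p * q + p * d) * (1 / d.factorial) := by gcongr
    _ = r ^ (p * q) * ((r ^ p) ^ d / d.factorial) := by rw [pow_add, pow_mul r p d]; ring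
    _ ≤ r ^ (p * q) * Real.exp (r ^ p) := by
      gcongr
      exact Real.pow_div_factorial_le_exp _ (by positivity) d

theorem exists_norm_wright_coeff_mul_pow_le {l : ℝ} (hl : -1 < l) (μ : ℂ) {r : ℝ} (hr : 1 ≤ r) :
    ∃ B : ℝ, ∀ᶠ n : ℕ in Filter.atTop,
      r ^ n / (n.factorial * ‖Complex.Gamma (((l * n : ℝ) : ℂ) + μ)‖) ≤ B := by
  obtain ⟨M, N, hM, h⟩ := exists_norm_inv_Gamma_le_mul_factorial |μ.im|
  set a := max (-l) 0
  have ha : a < 1 := max_lt (by linarith) one_pos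
  have ha0 : 0 ≤ a := le_max_right _ _
  have hal : -l ≤ a := le_max_left _ _
  obtain ⟨B, hB⟩ := exists_pow_mul_factorial_div_factorial_le ha (|μ.re| + 2 + N)
    (m := fun n ↦ ⌈a * n + (|μ.re| + 1)⌉₊ + N)
    (fun n ↦ by
      have := Nat.ceil_lt_add_one (a := a * n + (|μ.re| + 1)) (by positivity)
      push_cast
      linarith) hr
  refine ⟨M * B, hB.mono fun n hn ↦ ?_⟩
  have hG := h ⌈a * n + (|μ.re| + 1)⌉₊ (((l * n : ℝ) : ℂ) + μ) (by simp) (by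
    have h1 := Nat.le_ceil (a * n + (|μ.re| + 1))
    have h2 : -l * n ≤ a * n := by gcongr
    have h3 := neg_abs_le μ.re
    rw [Complex.add_re, Complex.ofReal_re]
    linarith)
  rw [norm_inv] at hG
  calc r ^ n / (n.factorial * ‖Complex.Gamma (((l * n : ℝ) : ℂ) + μ)‖)
      = r ^ n / n.factorial * ‖Complex.Gamma (((l * n : ℝ) : ℂ) + μ)‖⁻¹ := by
        rw [div_mul_eq_div_div, div_eq_mul_inv (r ^ n / _)]
    _ ≤ r ^ n / n.factorial * (M * (⌈a * n + (|μ.re| + 1)⌉₊ + N).factorial) := by gcongr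
    _ = M * (r ^ n * ((⌈a * n + (|μ.re| + 1)⌉₊ + N).factorial / n.factorial)) := by ring
    _ ≤ M * B := by gcongr

theorem summable_norm_wright {l : ℝ} (hl : -1 < l) (μ z : ℂ) :
    Summable fun n : ℕ =>
      ‖z ^ n / ((n.factorial : ℂ) * Complex.Gamma (((l * n : ℝ) : ℂ) + μ))‖ := by
  obtain ⟨B, hB⟩ := exists_norm_wright_coeff_mul_pow_le hl μ
    (r := 2 * (‖z‖ + 1)) (by linarith [norm_nonneg z])
  refine Summable.of_norm_bounded_eventually_nat
    (summable_geometric_two.mul_left B) (hB.mono fun n hn ↦ ?_)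
  rw [norm_norm, norm_div, norm_mul, norm_pow, Complex.norm_natCast]
  calc ‖z‖ ^ n / (n.factorial * ‖Complex.Gamma (((l * n : ℝ) : ℂ) + μ)‖)
      ≤ (‖z‖ + 1) ^ n / (n.factorial * ‖Complex.Gamma (((l * n : ℝ) : ℂ) + μ)‖) := by
        gcongr; linarith
    _ = (2 * (‖z‖ + 1)) ^ n / (n.factorial * ‖Complex.Gamma (((l * n : ℝ) : ℂ) + μ)‖)
          * (1 / 2) ^ n := by
        rw [mul_pow, div_mul_eq_mul_div, mul_right_comm, ← mul_pow]; norm_num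
    _ ≤ B * (1 / 2) ^ n := by gcongr

theorem wright_summable_and_entire (l : ℝ) (hl : -1 < l) (μ : ℂ) :
    (∀ z : ℂ,
      Summable fun n : ℕ =>
        ‖z ^ n / ((n.factorial : ℂ) * Complex.Gamma (((l * n : ℝ) : ℂ) + μ))‖) ∧
    Differentiable ℂ (wrightC l μ) := by
  refine ⟨summable_norm_wright hl μ, fun z ↦ ?_⟩
  have hs := summable_norm_wright hl μ ((‖z‖ + 1 : ℝ) : ℂ)
  have hd := Complex.differentiableOn_tsum_of_summable_norm (U := Metric.ball (0 : ℂ) (‖z‖ + 1))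
    (F := fun (n : ℕ) (w : ℂ) ↦
      w ^ n / ((n.factorial : ℂ) * Complex.Gamma (((l * n : ℝ) : ℂ) + μ))) hs
    (fun n ↦ by fun_prop) Metric.isOpen_ball (fun n w hw ↦ by
      simp only [norm_div, norm_pow, Complex.norm_real]
      gcongr
      rw [mem_ball_zero_iff] at hw
      exact hw.le.trans (le_abs_self _))
  exact hd.differentiableAt (Metric.isOpen_ball.mem_nhds (by simp))
end

section
/- Let λ > 0 be real, μ ∈ ℝ, and s > 0. Then ∫_0^∞ e^{-s r} · W_{λ,μ}(-r) dr = (1/s) · E_{λ,μ}(-1/s), where both the Laplace integral and the Mittag-Leffler series converge. -/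
/-- The Wright function `W_{λ,μ}(x) = ∑ xⁿ/(n!·Γ(λn+μ))` for real parameters and
real argument, with the convention `1/Γ(w) = 0` at poles of `Γ`. -/
noncomputable def wright (l μ x : ℝ) : ℝ :=
  ∑' n : ℕ, x ^ n / ((n.factorial : ℝ) * Real.Gamma (l * n + μ))

/-- The Mittag-Leffler function `E_{α,β}(x) = ∑ xⁿ/Γ(αn+β)`. -/
noncomputable def mittagLeffler (α β x : ℝ) : ℝ :=
  ∑' n : ℕ, x ^ n / Real.Gamma (α * n + β)

open MeasureTheory Set Filter

/-- A lower bound for the Gamma function that grows faster than any exponential in `x`,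
since `A` is arbitrary. -/
theorem Real.rpow_mul_exp_neg_le_Gamma {A x : ℝ} (hA : 0 < A) (hx : 1 ≤ x) :
    A ^ (x - 1) * Real.exp (-A) ≤ Real.Gamma x := by
  have hint := Real.GammaIntegral_convergent (zero_lt_one.trans_le hx)
  rw [Real.Gamma_eq_integral (zero_lt_one.trans_le hx), ← integral_exp_neg_Ioi A,
    ← integral_const_mul]
  calc ∫ t in Ioi A, A ^ (x - 1) * Real.exp (-t)
      ≤ ∫ t in Ioi A, Real.exp (-t) * t ^ (x - 1) := by
        refine setIntegral_mono_on ((integrableOn_exp_neg_Ioi A).const_mul _)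
          (hint.mono_set (Ioi_subset_Ioi hA.le)) measurableSet_Ioi fun t ht => ?_
        rw [mul_comm]
        have ht' : A ≤ t := le_of_lt ht
        gcongr
    _ ≤ ∫ t in Ioi 0, Real.exp (-t) * t ^ (x - 1) := by
        refine setIntegral_mono_set hint ?_ (Ioi_subset_Ioi hA.le).eventuallyLE
        filter_upwards [ae_restrict_mem measurableSet_Ioi] with t ht
        have ht' : (0 : ℝ) < t := ht
        simp only [Pi.zero_apply]
        positivity

/-- The Mittag-Leffler series converges absolutely everywhere. -/
theorem summable_norm_mittagLeffler {l : ℝ} (hl : 0 < l) (μ x : ℝ) :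
    Summable fun n : ℕ => ‖x ^ n / Real.Gamma (l * n + μ)‖ := by
  obtain ⟨A, hA, hAx⟩ : ∃ A : ℝ, 0 < A ∧ 2 * |x| + 1 ≤ A ^ l :=
    ((eventually_gt_atTop 0).and
      ((tendsto_rpow_atTop hl).eventually_ge_atTop (2 * |x| + 1))).exists
  have hAl : 0 < A ^ l := Real.rpow_pos_of_pos hA l
  have hgeom : Summable fun n : ℕ => Real.exp A * A ^ (1 - μ) * (|x| / A ^ l) ^ n := by
    refine (summable_geometric_of_lt_one (by positivity) ?_).mul_left _
    rw [div_lt_one hAl]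
    linarith [abs_nonneg x]
  refine Summable.of_norm_bounded_eventually_nat hgeom ?_
  have htend : Tendsto (fun n : ℕ => l * (n : ℝ) + μ) atTop atTop :=
    tendsto_atTop_add_const_right _ _ (tendsto_natCast_atTop_atTop.const_mul_atTop hl)
  filter_upwards [htend.eventually_ge_atTop 1] with n hn
  have hΓ := Real.rpow_mul_exp_neg_le_Gamma hA hn
  have hΓpos : 0 < Real.Gamma (l * n + μ) := Real.Gamma_pos_of_pos (zero_lt_one.trans_le hn)
  have hpow : A ^ (l * n + μ - 1) = (A ^ l) ^ n * (A ^ (1 - μ))⁻¹ := by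
    rw [← Real.rpow_natCast, ← Real.rpow_mul hA.le, ← Real.rpow_neg hA.le, ← Real.rpow_add hA]
    ring_nf
  rw [norm_norm, norm_div, norm_pow, Real.norm_eq_abs, Real.norm_of_nonneg hΓpos.le]
  calc |x| ^ n / Real.Gamma (l * n + μ)
      ≤ |x| ^ n / (A ^ (l * n + μ - 1) * Real.exp (-A)) := by gcongr
    _ = Real.exp A * A ^ (1 - μ) * (|x| / A ^ l) ^ n := by
        rw [hpow, Real.exp_neg, div_pow]
        field_simp

/-- Termwise Laplace transform of an exponential generating function of exponential type `q`. -/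
theorem hasSum_laplace_of_le_geometric {c : ℕ → ℝ} {C q s : ℝ} (hqs : q < s) (hs : 0 < s)
    (hc : ∀ n, |c n| ≤ C * q ^ n) :
    IntegrableOn (fun r : ℝ => Real.exp (-s * r) * ∑' n, c n * (r ^ n / n.factorial)) (Ioi 0) ∧
    HasSum (fun n => c n / s ^ (n + 1))
      (∫ r in Ioi (0 : ℝ), Real.exp (-s * r) * ∑' n, c n * (r ^ n / n.factorial)) := by
  set F : ℕ → ℝ → ℝ := fun n r => Real.exp (-s * r) * (c n * (r ^ n / n.factorial)) with hF
  set B : ℕ → ℝ → ℝ := fun n r => Real.exp (-s * r) * (C * ((q * r) ^ n / n.factorial)) with hB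
  have hFmeas (n : ℕ) : AEStronglyMeasurable (F n) (volume.restrict (Ioi 0)) := by
    have : Continuous (F n) := by fun_prop
    exact this.aestronglyMeasurable
  have hBsum (r : ℝ) : HasSum (fun n => B n r) (C * Real.exp (-(s - q) * r)) := by
    have h := NormedSpace.expSeries_div_hasSum_exp (q * r)
    rw [← Real.exp_eq_exp_ℝ] at h
    have hexp : Real.exp (-s * r) * (C * Real.exp (q * r)) = C * Real.exp (-(s - q) * r) := by
      rw [mul_left_comm, ← Real.exp_add]
      ring_nf
    exact hexp ▸ (h.mul_left C).mul_left (Real.exp (-s * r))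
  have hFB (n : ℕ) {r : ℝ} (hr : 0 < r) : ‖F n r‖ ≤ B n r := by
    simp only [hF, hB, norm_mul, norm_div, norm_pow, Real.norm_eq_abs, Real.abs_exp,
      abs_of_pos hr, Nat.abs_cast, mul_pow]
    calc _ ≤ Real.exp (-s * r) * ((C * q ^ n) * (r ^ n / n.factorial)) := by
          gcongr
          exact hc n
      _ = _ := by ring
  have hFsum {r : ℝ} (hr : 0 < r) :
      HasSum (fun n => F n r) (Real.exp (-s * r) * ∑' n, c n * (r ^ n / n.factorial)) := by
    rw [← tsum_mul_left]
    exact ((hBsum r).summable.of_norm_bounded fun n => hFB n hr).hasSum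
  have hBint : IntegrableOn (fun r => C * Real.exp (-(s - q) * r)) (Ioi 0) :=
    (exp_neg_integrableOn_Ioi 0 (sub_pos.2 hqs)).const_mul C
  refine ⟨hBint.mono' (aestronglyMeasurable_of_tendsto_ae atTop
    (f := fun N r => ∑ n ∈ Finset.range N, F n r) (fun N => ?_) ?_) ?_, ?_⟩
  · exact Finset.aestronglyMeasurable_fun_sum _ fun n _ => hFmeas n
  · filter_upwards [ae_restrict_mem measurableSet_Ioi] with r hr
    exact (hFsum hr).tendsto_sum_nat
  · filter_upwards [ae_restrict_mem measurableSet_Ioi] with r hr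
    rw [← (hFsum hr).tsum_eq]
    exact tsum_of_norm_bounded (hBsum r) fun n => hFB n hr
  · have hterm (n : ℕ) : ∫ r in Ioi 0, F n r = c n / s ^ (n + 1) := by
      have h := Real.integral_rpow_mul_exp_neg_mul_Ioi (a := n + 1) (by positivity) hs
      rw [Real.Gamma_nat_eq_factorial, ← Nat.cast_add_one, Real.rpow_natCast] at h
      have hn : (n.factorial : ℝ) ≠ 0 := by positivity
      calc ∫ r in Ioi 0, F n r
          = ∫ r in Ioi (0 : ℝ),
              c n / n.factorial * (r ^ (((n + 1 : ℕ) : ℝ) - 1) * Real.exp (-(s * r))) := by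
            refine integral_congr_ae (ae_of_all _ fun r => ?_)
            simp only [hF, Nat.cast_add_one, add_sub_cancel_right, Real.rpow_natCast, neg_mul]
            ring
        _ = c n / s ^ (n + 1) := by
            rw [integral_const_mul, h, one_div_pow]
            field_simp
    simp only [← hterm]
    refine hasSum_integral_of_dominated_convergence B hFmeas (fun n => ?_)
      (ae_of_all _ fun r => (hBsum r).summable) ?_ ?_
    · filter_upwards [ae_restrict_mem measurableSet_Ioi] with r hr using hFB n hr
    · simp only [(hBsum _).tsum_eq]
      exact hBint
    · filter_upwards [ae_restrict_mem measurableSet_Ioi] with r hr using hFsum hr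

theorem laplace_wright_first_kind (l μ : ℝ) (hl : 0 < l) (s : ℝ) (hs : 0 < s) :
    MeasureTheory.IntegrableOn
      (fun r : ℝ => Real.exp (-s * r) * wright l μ (-r)) (Set.Ioi 0) ∧
    (Summable fun n : ℕ => (-(1 / s)) ^ n / Real.Gamma (l * n + μ)) ∧
    ∫ r in Set.Ioi (0 : ℝ), Real.exp (-s * r) * wright l μ (-r) =
      (1 / s) * mittagLeffler l μ (-(1 / s)) := by
  set c : ℕ → ℝ := fun n => (-1) ^ n / Real.Gamma (l * n + μ) with hc
  have hwright (r : ℝ) : wright l μ (-r) = ∑' n, c n * (r ^ n / n.factorial) := by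
    refine tsum_congr fun n => ?_
    rw [hc, neg_pow, mul_comm (n.factorial : ℝ), mul_div_mul_comm]
  obtain ⟨C, hC⟩ := (summable_norm_mittagLeffler hl μ (2 / s)).tendsto_atTop_zero.bddAbove_range
  have hbound (n : ℕ) : |c n| ≤ C * (s / 2) ^ n := by
    have h := hC (mem_range_self n)
    rw [norm_div, norm_pow, Real.norm_of_nonneg (by positivity : 0 ≤ 2 / s)] at h
    calc |c n| = (2 / s) ^ n / ‖Real.Gamma (l * n + μ)‖ * (s / 2) ^ n := by
          rw [hc, abs_div, abs_pow, abs_neg, abs_one, one_pow, div_mul_eq_mul_div, ← mul_pow,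
            div_mul_div_cancel₀ hs.ne', div_self two_ne_zero, one_pow, Real.norm_eq_abs]
      _ ≤ C * (s / 2) ^ n := by gcongr
  obtain ⟨hint, hsum⟩ := hasSum_laplace_of_le_geometric (half_lt_self hs) hs hbound
  simp only [hwright]
  refine ⟨hint, (summable_norm_mittagLeffler hl μ _).of_norm, ?_⟩
  rw [← hsum.tsum_eq, mittagLeffler, ← tsum_mul_left]
  refine tsum_congr fun n => ?_
  rw [hc, neg_pow, one_div_pow, pow_succ]
  field_simp
end

section
/- Let 0 < ν < 1, μ ∈ ℝ, and s > 0. Then ∫_0^∞ e^{-s r} · W_{-ν,μ}(-r) dr = E_{ν, μ+ν}(-s); in particular the integrand is integrable on (0,∞). -/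
open MeasureTheory Real Set Filter Topology

/-- Parametrization, in the logarithmic coordinate, of the upper half of the Hankel contour: the
vertical segment from `L` to `L + θ i` for `t ∈ [L - θ, L]`, then the horizontal ray to the right. -/
noncomputable def hankelPoint (L θ t : ℝ) : ℂ :=
  (max t L : ℝ) + (min (t - L + θ) θ : ℝ) * Complex.I

/-- The velocity of `hankelPoint`. -/
noncomputable def hankelDir (L t : ℝ) : ℂ := if t ≤ L then Complex.I else 1

lemma continuous_hankelPoint (L θ : ℝ) : Continuous (hankelPoint L θ) := by
  unfold hankelPoint; fun_prop

lemma hankelPoint_re (L θ t : ℝ) : (hankelPoint L θ t).re = max t L := by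
  simp [hankelPoint]

lemma hankelPoint_im (L θ t : ℝ) : (hankelPoint L θ t).im = min (t - L + θ) θ := by
  simp [hankelPoint]

lemma hankelPoint_of_le {L t : ℝ} (θ : ℝ) (h : t ≤ L) :
    hankelPoint L θ t = L + (t - L + θ : ℝ) * Complex.I := by
  rw [hankelPoint, max_eq_right h, min_eq_left (by linarith)]

lemma hankelPoint_of_ge {L t : ℝ} (θ : ℝ) (h : L ≤ t) :
    hankelPoint L θ t = t + θ * Complex.I := by
  rw [hankelPoint, max_eq_left h, min_eq_right (by linarith)]

lemma measurable_hankelDir (L : ℝ) : Measurable (hankelDir L) := by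
  unfold hankelDir
  exact Measurable.ite measurableSet_Iic measurable_const measurable_const

lemma norm_hankelDir (L t : ℝ) : ‖hankelDir L t‖ = 1 := by
  unfold hankelDir; split_ifs <;> simp

/-- Double exponential decay dominates any single exponential and any smaller power of it. -/
lemma integrableOn_exp_neg_exp {κ ν : ℝ} (hκ : 0 < κ) (hν : ν < 1) (L a r : ℝ) :
    IntegrableOn (fun x : ℝ => rexp (-κ * rexp x + a * x + r * rexp (ν * x))) (Ioi L) := by
  refine integrable_of_isBigO_exp_neg (b := 1) one_pos (by fun_prop) ?_
  refine Asymptotics.IsBigO.of_bound 1 ?_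
  have h1 : Tendsto (fun x : ℝ => r * rexp (-(1 - ν) * x)) atTop (𝓝 (r * 0)) := by
    refine Tendsto.const_mul _ ?_
    refine tendsto_exp_atBot.comp ?_
    exact tendsto_id.const_mul_atTop_of_neg (by linarith)
  have h2 : Tendsto (fun x : ℝ => (a + 1) * (x ^ 1 * rexp (-x))) atTop (𝓝 ((a + 1) * 0)) :=
    (tendsto_pow_mul_exp_neg_atTop_nhds_zero 1).const_mul _
  have h3 := h1.add h2
  simp only [mul_zero, add_zero] at h3
  filter_upwards [h3.eventually (gt_mem_nhds hκ)] with x hx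
  rw [norm_of_nonneg (exp_pos _).le, norm_of_nonneg (exp_pos _).le, one_mul, exp_le_exp]
  have h4 := mul_le_mul_of_nonneg_right hx.le (exp_pos x).le
  have e1 : rexp (-(1 - ν) * x) * rexp x = rexp (ν * x) := by rw [← exp_add]; congr 1; ring
  have e2 : rexp (-x) * rexp x = 1 := by rw [← exp_add]; simp
  have : (r * rexp (-(1 - ν) * x) + (a + 1) * (x ^ 1 * rexp (-x))) * rexp x
      = r * rexp (ν * x) + (a + 1) * x := by
    rw [← e1]; linear_combination (a + 1) * x * e2
  linarith

/-- The modulus of `exp (exp z)` times growing factors is integrable along the contour. -/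
lemma integrableOn_hankel_bound {θ ν : ℝ} (hθ : cos θ < 0) (hν : ν < 1) (L a r : ℝ) :
    IntegrableOn (fun t : ℝ => ‖Complex.exp (Complex.exp (hankelPoint L θ t))‖ *
      rexp (a * max t L) * rexp (r * rexp (ν * max t L))) (Ioi (L - θ)) := by
  have hc := continuous_hankelPoint L θ
  have hcont : Continuous (fun t : ℝ => ‖Complex.exp (Complex.exp (hankelPoint L θ t))‖ *
      rexp (a * max t L) * rexp (r * rexp (ν * max t L))) := by fun_prop
  have h1 : IntegrableOn (fun t : ℝ => ‖Complex.exp (Complex.exp (hankelPoint L θ t))‖ *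
      rexp (a * max t L) * rexp (r * rexp (ν * max t L))) (Icc (L - θ) L) :=
    hcont.continuousOn.integrableOn_Icc
  have h2 : IntegrableOn (fun t : ℝ => ‖Complex.exp (Complex.exp (hankelPoint L θ t))‖ *
      rexp (a * max t L) * rexp (r * rexp (ν * max t L))) (Ioi L) := by
    refine (integrableOn_exp_neg_exp (κ := -cos θ) (by linarith) hν L a r).congr_fun ?_
      measurableSet_Ioi
    intro t ht
    have ht' : L ≤ t := le_of_lt ht
    simp only [hankelPoint_of_ge θ ht', Complex.norm_exp, Complex.exp_re, max_eq_left ht',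
      exp_add]
    simp [mul_comm]
  refine (h1.union h2).mono_set ?_
  intro t ht
  rcases le_or_gt t L with h | h
  · exact Or.inl ⟨le_of_lt ht, h⟩
  · exact Or.inr h

/-- The integrand of Hankel's integral in the logarithmic coordinate. -/
noncomputable def hankelIntegrand (a : ℝ) (z : ℂ) : ℂ :=
  Complex.exp (Complex.exp z) * Complex.exp (a * z)

lemma differentiable_hankelIntegrand (a : ℝ) : Differentiable ℂ (hankelIntegrand a) := by
  unfold hankelIntegrand; fun_prop

lemma continuous_hankelIntegrand (a : ℝ) : Continuous (hankelIntegrand a) :=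
  (differentiable_hankelIntegrand a).continuous

lemma norm_hankelIntegrand (a x y : ℝ) :
    ‖hankelIntegrand a (x + y * Complex.I)‖ = rexp (rexp x * cos y + a * x) := by
  simp [hankelIntegrand, Complex.norm_exp, Complex.exp_re, exp_add]

lemma integrable_hankelIntegrand {a θ : ℝ} (ha : 0 < a) (hθ : cos θ < 0) :
    Integrable (fun x : ℝ => hankelIntegrand a (x + θ * Complex.I)) := by
  have hc : Continuous (fun x : ℝ => hankelIntegrand a (x + θ * Complex.I)) := by
    have := continuous_hankelIntegrand a
    fun_prop
  rw [← integrableOn_univ, ← Iic_union_Ioi (a := (0 : ℝ)), integrableOn_union]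
  constructor
  · refine (integrableOn_exp_mul_Iic ha 0).mono' hc.aestronglyMeasurable ?_
    refine Eventually.of_forall fun x => ?_
    rw [norm_hankelIntegrand, exp_le_exp]
    nlinarith [exp_pos x]
  · refine (integrableOn_exp_neg_exp (κ := -cos θ) (ν := 0) (by linarith) (by norm_num) 0 a 0).mono'
      hc.aestronglyMeasurable ?_
    refine Eventually.of_forall fun x => ?_
    rw [norm_hankelIntegrand, exp_le_exp]
    linarith

lemma tendsto_vertical_atBot {a : ℝ} (ha : 0 < a) (α β : ℝ) :
    Tendsto (fun x : ℝ => ∫ y in α..β, hankelIntegrand a (x + y * Complex.I)) atBot (𝓝 0) := by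
  have hb : Tendsto (fun x : ℝ => rexp (rexp x + a * x) * |β - α|) atBot (𝓝 (0 * |β - α|)) := by
    refine Tendsto.mul_const _ (tendsto_exp_atBot.comp ?_)
    exact tendsto_exp_atBot.add_atBot (tendsto_id.const_mul_atBot ha)
  rw [zero_mul] at hb
  refine squeeze_zero_norm (fun x => ?_) hb
  refine intervalIntegral.norm_integral_le_of_norm_le_const fun y _ => ?_
  rw [norm_hankelIntegrand, exp_le_exp]
  nlinarith [exp_pos x, cos_le_one y]

lemma tendsto_exp_neg_exp {κ : ℝ} (hκ : κ < 0) (a : ℝ) :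
    Tendsto (fun x : ℝ => rexp (rexp x * κ + a * x)) atTop (𝓝 0) := by
  refine tendsto_exp_atBot.comp ?_
  have e : (fun x : ℝ => rexp x * κ + a * x)
      = fun x => rexp x * (κ + a * (x ^ 1 * rexp (-x))) := by
    funext x
    have : rexp (-x) * rexp x = 1 := by rw [← exp_add]; simp
    linear_combination (-a * x) * this
  rw [e]
  have : Tendsto (fun x : ℝ => κ + a * (x ^ 1 * rexp (-x))) atTop (𝓝 (κ + a * 0)) :=
    ((tendsto_pow_mul_exp_neg_atTop_nhds_zero 1).const_mul _).const_add _
  exact tendsto_exp_atTop.atTop_mul_neg (by simpa using hκ) this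

lemma tendsto_vertical_atTop {a θ : ℝ} (h0 : 0 ≤ θ) (h1 : θ ≤ π) (hθ : cos θ < 0) :
    Tendsto (fun x : ℝ => ∫ y in θ..π, hankelIntegrand a (x + y * Complex.I)) atTop (𝓝 0) := by
  have hb : Tendsto (fun x : ℝ => rexp (rexp x * cos θ + a * x) * |π - θ|) atTop
      (𝓝 (0 * |π - θ|)) := by
    exact (tendsto_exp_neg_exp hθ a).mul_const _
  rw [zero_mul] at hb
  refine squeeze_zero_norm (fun x => ?_) hb
  refine intervalIntegral.norm_integral_le_of_norm_le_const fun y hy => ?_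
  rw [uIoc_of_le h1] at hy
  rw [norm_hankelIntegrand, exp_le_exp]
  have := cos_le_cos_of_nonneg_of_le_pi h0 hy.2 hy.1.le
  nlinarith [exp_pos x]

lemma integral_rect_hankelIntegrand (a x₀ x₁ y₀ y₁ : ℝ) :
    (∫ x : ℝ in x₀..x₁, hankelIntegrand a (x + y₀ * Complex.I)) -
      (∫ x : ℝ in x₀..x₁, hankelIntegrand a (x + y₁ * Complex.I)) +
      Complex.I * (∫ y : ℝ in y₀..y₁, hankelIntegrand a (x₁ + y * Complex.I)) -
      Complex.I * (∫ y : ℝ in y₀..y₁, hankelIntegrand a (x₀ + y * Complex.I)) = 0 := by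
  simpa using Complex.integral_boundary_rect_eq_zero_of_differentiableOn (hankelIntegrand a)
    ⟨x₀, y₀⟩ ⟨x₁, y₁⟩ (differentiable_hankelIntegrand a).differentiableOn

lemma integral_exp_neg_exp {a : ℝ} (ha : 0 < a) :
    ∫ x : ℝ, rexp (-rexp x) * rexp (a * x) = Real.Gamma a := by
  rw [Real.Gamma_eq_integral ha]
  have h := integral_image_eq_integral_abs_deriv_smul (s := univ) (f := rexp) (f' := rexp)
    MeasurableSet.univ (fun x _ => (hasDerivAt_exp x).hasDerivWithinAt) exp_injective.injOn
    (fun x => rexp (-x) * x ^ (a - 1))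
  rw [image_univ, range_exp, setIntegral_univ] at h
  rw [h]
  congr 1
  funext x
  rw [abs_of_pos (exp_pos x), smul_eq_mul, ← exp_mul]
  simp only [← exp_add]
  congr 1
  ring

lemma integral_hankelIntegrand_pi {a : ℝ} (ha : 0 < a) :
    ∫ x : ℝ, hankelIntegrand a (x + (π : ℝ) * Complex.I) =
      Real.Gamma a * Complex.exp (a * π * Complex.I) := by
  rw [← integral_exp_neg_exp ha, ← integral_complex_ofReal, ← integral_mul_const]
  congr 1
  funext x
  rw [hankelIntegrand, Complex.exp_add, Complex.exp_pi_mul_I, mul_add, Complex.exp_add]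
  push_cast
  ring_nf

lemma integral_hankelIntegrand {a θ : ℝ} (ha : 0 < a) (h0 : 0 ≤ θ) (h1 : θ ≤ π)
    (hθ : cos θ < 0) :
    ∫ x : ℝ, hankelIntegrand a (x + θ * Complex.I) =
      Real.Gamma a * Complex.exp (a * π * Complex.I) := by
  rw [← integral_hankelIntegrand_pi ha]
  have hneg : Tendsto (fun T : ℝ => -T) atTop atBot := tendsto_neg_atTop_atBot
  have t1 := intervalIntegral_tendsto_integral (integrable_hankelIntegrand ha hθ) hneg tendsto_id
  have t2 := intervalIntegral_tendsto_integral
    (integrable_hankelIntegrand (θ := π) ha (by simp)) hneg tendsto_id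
  have t3 := (tendsto_vertical_atTop (a := a) h0 h1 hθ).const_mul Complex.I
  have t4 := ((tendsto_vertical_atBot ha θ π).comp hneg).const_mul Complex.I
  have t := ((t1.sub t2).add t3).sub t4
  have hz := tendsto_nhds_unique t (tendsto_const_nhds.congr fun T =>
    (integral_rect_hankelIntegrand a (-T) T θ π).symm)
  simp only [mul_zero, add_zero, sub_zero] at hz
  exact sub_eq_zero.mp hz

/-- Integral along the upper half of the Hankel contour. -/
noncomputable def hankelIntegral (L θ : ℝ) (F : ℂ → ℂ) : ℂ :=
  ∫ t in Ioi (L - θ), hankelDir L t *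
    (Complex.exp (Complex.exp (hankelPoint L θ t)) * F (hankelPoint L θ t))

lemma integrableOn_hankel {θ : ℝ} (hθ : cos θ < 0) {L a C : ℝ} {F : ℂ → ℂ}
    (hF : Continuous fun t => F (hankelPoint L θ t))
    (hb : ∀ t, ‖F (hankelPoint L θ t)‖ ≤ C * rexp (a * max t L)) :
    IntegrableOn (fun t => hankelDir L t *
      (Complex.exp (Complex.exp (hankelPoint L θ t)) * F (hankelPoint L θ t))) (Ioi (L - θ)) := by
  have hc := continuous_hankelPoint L θ
  refine ((integrableOn_hankel_bound hθ (ν := 0) (by norm_num) L a 0).const_mul C).mono' ?_ ?_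
  · exact (measurable_hankelDir L).aestronglyMeasurable.mul
      (Continuous.aestronglyMeasurable (by
        exact (Complex.continuous_exp.comp (Complex.continuous_exp.comp hc)).mul hF))
  · refine Eventually.of_forall fun t => ?_
    rw [norm_mul, norm_hankelDir, one_mul, norm_mul]
    have := mul_le_mul_of_nonneg_left (hb t)
      (norm_nonneg (Complex.exp (Complex.exp (hankelPoint L θ t))))
    simp only [zero_mul, exp_zero, mul_one]
    linarith

lemma norm_exp_mul_hankelPoint (L θ a t : ℝ) :
    ‖Complex.exp (a * hankelPoint L θ t)‖ = rexp (a * max t L) := by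
  simp [Complex.norm_exp, hankelPoint_re]

lemma integrableOn_hankel_exp {θ : ℝ} (hθ : cos θ < 0) (L a : ℝ) :
    IntegrableOn (fun t => hankelDir L t * (Complex.exp (Complex.exp (hankelPoint L θ t)) *
      Complex.exp (a * hankelPoint L θ t))) (Ioi (L - θ)) := by
  have hc := continuous_hankelPoint L θ
  refine integrableOn_hankel hθ (a := a) (C := 1) (F := fun z => Complex.exp (a * z))
    (by fun_prop) fun t => ?_
  rw [norm_exp_mul_hankelPoint, one_mul]

lemma hankelIntegral_eq_arc_add_ray {θ : ℝ} (h0 : 0 ≤ θ) (hθ : cos θ < 0) (L a : ℝ) :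
    hankelIntegral L θ (fun z => Complex.exp (a * z)) =
      Complex.I * (∫ y in 0..θ, hankelIntegrand a (L + y * Complex.I)) +
        ∫ x in Ioi L, hankelIntegrand a (x + θ * Complex.I) := by
  have hint := integrableOn_hankel_exp hθ L a
  have hle : L - θ ≤ L := by linarith
  rw [hankelIntegral, ← Ioc_union_Ioi_eq_Ioi hle,
    setIntegral_union (Ioc_disjoint_Ioi le_rfl) measurableSet_Ioi
      (hint.mono_set Ioc_subset_Ioi_self) (hint.mono_set (Ioi_subset_Ioi hle))]
  congr 1
  · have := intervalIntegral.integral_comp_add_right (a := L - θ) (b := L)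
      (fun y : ℝ => hankelIntegrand a (L + y * Complex.I)) (θ - L)
    rw [show L - θ + (θ - L) = 0 by ring, show L + (θ - L) = θ by ring] at this
    rw [← this, intervalIntegral.integral_of_le hle, ← integral_const_mul]
    refine setIntegral_congr_fun measurableSet_Ioc fun t ht => ?_
    simp only [hankelDir, if_pos ht.2, hankelPoint_of_le θ ht.2, hankelIntegrand]
    rw [show t - L + θ = t + (θ - L) by ring]
  · refine setIntegral_congr_fun measurableSet_Ioi fun t ht => ?_
    simp only [hankelDir, if_neg (not_le.mpr (mem_Ioi.mp ht)), hankelPoint_of_ge θ (le_of_lt ht),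
      hankelIntegrand, one_mul]

lemma hankelIntegrand_im_of_real (a x : ℝ) : (hankelIntegrand a x).im = 0 := by
  rw [hankelIntegrand]
  norm_cast

/-- Hankel's formula for the reciprocal Gamma function left of `1`. -/
lemma hankelIntegral_im_of_pos {a θ : ℝ} (ha : 0 < a) (h0 : 0 ≤ θ) (h1 : θ ≤ π)
    (hθ : cos θ < 0) (L : ℝ) :
    (hankelIntegral L θ (fun z => Complex.exp (a * z))).im = π * (Real.Gamma (1 - a))⁻¹ := by
  have hint := integrable_hankelIntegrand ha hθ
  have t1 := intervalIntegral_tendsto_integral_Iic L hint.integrableOn tendsto_id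
  have t2 := (tendsto_vertical_atBot ha 0 θ).const_mul Complex.I
  have t3 := (Complex.continuous_im.tendsto _).comp (t1.add t2)
  have key : ∀ x : ℝ, ((∫ x in x..L, hankelIntegrand a (x + θ * Complex.I)) +
      Complex.I * (∫ y in 0..θ, hankelIntegrand a (x + y * Complex.I))).im =
      (Complex.I * (∫ y in 0..θ, hankelIntegrand a (L + y * Complex.I))).im := by
    intro x
    have h := congrArg Complex.im (integral_rect_hankelIntegrand a x L 0 θ)
    have hr : (∫ x : ℝ in x..L, hankelIntegrand a (x + (0 : ℝ) * Complex.I)).im = 0 := by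
      have hi : IntervalIntegrable (fun x : ℝ => hankelIntegrand a x) volume x L :=
        ((continuous_hankelIntegrand a).comp Complex.continuous_ofReal).intervalIntegrable _ _
      have := Complex.imCLM.intervalIntegral_comp_comm hi
      simp only [Complex.imCLM_apply, hankelIntegrand_im_of_real] at this
      simpa using this.symm
    simp only [Complex.sub_im, Complex.add_im, hr, Complex.zero_im] at h ⊢
    linarith
  have hz := tendsto_nhds_unique t3 (tendsto_const_nhds.congr fun x => (key x).symm)
  rw [hankelIntegral_eq_arc_add_ray h0 hθ, Complex.add_im, ← hz, mul_zero, add_zero,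
    ← Complex.add_im, intervalIntegral.integral_Iic_add_Ioi hint.integrableOn hint.integrableOn,
    integral_hankelIntegrand ha h0 h1 hθ]
  have hΓ := Real.Gamma_mul_Gamma_one_sub a
  have hne := (Real.Gamma_pos_of_pos ha).ne'
  have e : (↑(Real.Gamma a) * Complex.exp (a * π * Complex.I)).im = Real.Gamma a * sin (π * a) := by
    rw [Complex.im_ofReal_mul, ← Complex.ofReal_mul, Complex.exp_ofReal_mul_I_im, mul_comm π]
  rw [e]
  have h := congrArg (fun x => Real.Gamma a * (π * x⁻¹)) hΓ
  simp only [mul_inv, inv_div] at h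
  field_simp at h ⊢
  linarith

lemma hasDerivAt_hankelIntegrand (a : ℝ) (z : ℂ) :
    HasDerivAt (hankelIntegrand a) (hankelIntegrand (a + 1) z + a * hankelIntegrand a z) z := by
  have h1 : HasDerivAt (fun z => Complex.exp (Complex.exp z))
      (Complex.exp (Complex.exp z) * Complex.exp z) z := (Complex.hasDerivAt_exp z).cexp
  have h2 : HasDerivAt (fun z : ℂ => Complex.exp (a * z)) (Complex.exp (a * z) * (a * 1)) z :=
    ((hasDerivAt_id z).const_mul (a : ℂ)).cexp
  refine (h1.mul h2).congr_deriv ?_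
  simp only [hankelIntegrand, Complex.ofReal_add, Complex.ofReal_one, add_mul, Complex.exp_add,
    one_mul]
  ring

lemma integrableOn_hankelIntegrand_ray {θ : ℝ} (hθ : cos θ < 0) (L a : ℝ) :
    IntegrableOn (fun x : ℝ => hankelIntegrand a (x + θ * Complex.I)) (Ioi L) := by
  have hc : Continuous (fun x : ℝ => hankelIntegrand a (x + θ * Complex.I)) := by
    have := continuous_hankelIntegrand a
    fun_prop
  refine (integrableOn_exp_neg_exp (κ := -cos θ) (ν := 0) (by linarith) (by norm_num) L a 0).mono'
    hc.aestronglyMeasurable ?_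
  refine Eventually.of_forall fun x => ?_
  rw [norm_hankelIntegrand, exp_le_exp]
  linarith

/-- Integration by parts along the Hankel contour. -/
lemma hankelIntegral_add_one {θ : ℝ} (h0 : 0 ≤ θ) (hθ : cos θ < 0) (L a : ℝ) :
    (hankelIntegral L θ (fun z => Complex.exp ((a + 1 : ℝ) * z))).im =
      -a * (hankelIntegral L θ (fun z => Complex.exp (a * z))).im := by
  have hc := fun b => continuous_hankelIntegrand b
  have hray : (∫ x in Ioi L, (hankelIntegrand (a + 1) (x + θ * Complex.I) +
      a * hankelIntegrand a (x + θ * Complex.I))) = 0 - hankelIntegrand a (L + θ * Complex.I) := by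
    refine integral_Ioi_of_hasDerivAt_of_tendsto'
      (f := fun x : ℝ => hankelIntegrand a (x + θ * Complex.I)) (fun x _ => ?_) ?_ ?_
    · have h := (hasDerivAt_hankelIntegrand a (x + θ * Complex.I)).comp_add_const
        (x : ℂ) (θ * Complex.I)
      exact h.comp_ofReal
    · exact (integrableOn_hankelIntegrand_ray hθ L (a + 1)).add
        ((integrableOn_hankelIntegrand_ray hθ L a).const_mul _)
    · refine squeeze_zero_norm (fun x => ?_) (tendsto_exp_neg_exp hθ a)
      rw [norm_hankelIntegrand]
  have harc : (∫ y in 0..θ, Complex.I * (hankelIntegrand (a + 1) (L + y * Complex.I) +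
      a * hankelIntegrand a (L + y * Complex.I))) =
      hankelIntegrand a (L + θ * Complex.I) - hankelIntegrand a (L + (0 : ℝ) * Complex.I) := by
    refine intervalIntegral.integral_eq_sub_of_hasDerivAt
      (f := fun y : ℝ => hankelIntegrand a (L + y * Complex.I)) (fun y _ => ?_) ?_
    · have h1 : HasDerivAt (fun y : ℝ => (L : ℂ) + y * Complex.I) Complex.I y := by
        simpa using ((Complex.ofRealCLM.hasDerivAt (x := y)).mul_const Complex.I).const_add (L : ℂ)
      have h := (hasDerivAt_hankelIntegrand a (L + y * Complex.I)).scomp y h1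
      simpa [Function.comp_def] using h
    · refine Continuous.intervalIntegrable ?_ _ _
      have := hc a
      have := hc (a + 1)
      fun_prop
  have hii : ∀ b : ℝ, IntervalIntegrable
      (fun y : ℝ => hankelIntegrand b (L + y * Complex.I)) volume 0 θ := fun b => by
    have := hc b
    exact Continuous.intervalIntegrable (by fun_prop) _ _
  rw [integral_add (integrableOn_hankelIntegrand_ray hθ L (a + 1))
    ((integrableOn_hankelIntegrand_ray hθ L a).const_mul _), integral_const_mul] at hray
  rw [intervalIntegral.integral_const_mul, intervalIntegral.integral_add (hii _)
    ((hii _).const_mul _), intervalIntegral.integral_const_mul] at harc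
  have hsum : hankelIntegral L θ (fun z => Complex.exp ((a + 1 : ℝ) * z)) +
      a * hankelIntegral L θ (fun z => Complex.exp (a * z)) = -hankelIntegrand a L := by
    rw [hankelIntegral_eq_arc_add_ray h0 hθ, hankelIntegral_eq_arc_add_ray h0 hθ]
    rw [Complex.ofReal_zero, zero_mul, add_zero] at harc
    linear_combination hray + harc
  have h := congrArg Complex.im hsum
  rw [Complex.add_im, Complex.im_ofReal_mul, Complex.neg_im, hankelIntegrand_im_of_real] at h
  linarith

lemma continuousAt_hankelIntegral {θ : ℝ} (hθ : cos θ < 0) (L : ℝ) :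
    ContinuousAt (fun a : ℝ => hankelIntegral L θ (fun z => Complex.exp (a * z))) 0 := by
  have hc := continuous_hankelPoint L θ
  have h1 := integrableOn_hankel_bound hθ (ν := 0) (by norm_num) L 1 0
  have h2 := integrableOn_hankel_bound hθ (ν := 0) (by norm_num) L (-1) 0
  refine continuousAt_of_dominated ?_ ?_ (h1.add h2) ?_
  · exact Eventually.of_forall fun a => (integrableOn_hankel_exp hθ L a).aestronglyMeasurable
  · filter_upwards [Metric.ball_mem_nhds (0 : ℝ) one_pos] with a ha
    rw [mem_ball_zero_iff, norm_eq_abs, abs_lt] at ha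
    refine Eventually.of_forall fun t => ?_
    rw [norm_mul, norm_hankelDir, one_mul, norm_mul, norm_exp_mul_hankelPoint]
    simp only [Pi.add_apply, zero_mul, exp_zero, mul_one, ← mul_add]
    refine mul_le_mul_of_nonneg_left ?_ (norm_nonneg _)
    rcases le_total 0 (max t L) with hx | hx
    · have : rexp (a * max t L) ≤ rexp (1 * max t L) := exp_le_exp.mpr (by nlinarith)
      linarith [exp_pos (-1 * max t L)]
    · have : rexp (a * max t L) ≤ rexp (-1 * max t L) := exp_le_exp.mpr (by nlinarith)
      linarith [exp_pos (1 * max t L)]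
  · refine Eventually.of_forall fun t => Continuous.continuousAt ?_
    fun_prop

/-- Hankel's formula for the reciprocal Gamma function at real arguments. -/
lemma hankelIntegral_im {θ : ℝ} (h0 : 0 ≤ θ) (h1 : θ ≤ π) (hθ : cos θ < 0) (L a : ℝ) :
    (hankelIntegral L θ (fun z => Complex.exp (a * z))).im = π * (Real.Gamma (1 - a))⁻¹ := by
  have hzero : (hankelIntegral L θ (fun z => Complex.exp ((0 : ℝ) * z))).im =
      π * (Real.Gamma (1 - 0))⁻¹ := by
    have hl : Tendsto (fun a : ℝ => (hankelIntegral L θ (fun z => Complex.exp (a * z))).im)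
        (𝓝[>] 0) (𝓝 (hankelIntegral L θ (fun z => Complex.exp ((0 : ℝ) * z))).im) :=
      ((Complex.continuous_im.continuousAt.comp (continuousAt_hankelIntegral hθ L)).tendsto).mono_left
        nhdsWithin_le_nhds
    have hΓ : ContinuousAt Real.Gamma (1 - 0) := by
      refine (Real.differentiableAt_Gamma fun m => ?_).continuousAt
      have : (0 : ℝ) ≤ m := m.cast_nonneg
      linarith
    have hr : ContinuousAt (fun a : ℝ => π * (Real.Gamma (1 - a))⁻¹) 0 := by
      have hs : ContinuousAt (fun a : ℝ => 1 - a) 0 := by fun_prop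
      have := ContinuousAt.comp (f := fun a : ℝ => 1 - a) (g := Real.Gamma) hΓ hs
      exact (this.inv₀ (by simp)).const_mul _
    have hr' := hr.tendsto.mono_left (nhdsWithin_le_nhds (s := Ioi (0 : ℝ)))
    refine tendsto_nhds_unique hl (hr'.congr' ?_)
    filter_upwards [self_mem_nhdsWithin] with a ha
    exact (hankelIntegral_im_of_pos ha h0 h1 hθ L).symm
  have hind : ∀ n : ℕ, ∀ a : ℝ, -(n : ℝ) < a →
      (hankelIntegral L θ (fun z => Complex.exp (a * z))).im = π * (Real.Gamma (1 - a))⁻¹ := by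
    intro n
    induction n with
    | zero => exact fun a ha => hankelIntegral_im_of_pos (by simpa using ha) h0 h1 hθ L
    | succ n ih =>
      intro a ha
      rcases eq_or_ne a 0 with rfl | hne
      · exact hzero
      · have h := ih (a + 1) (by push_cast at ha; linarith)
        rw [hankelIntegral_add_one h0 hθ, show 1 - (a + 1) = -a by ring] at h
        rw [show 1 - a = -a + 1 by ring, Real.Gamma_add_one (neg_ne_zero.mpr hne), mul_inv]
        have hna := neg_ne_zero.mpr hne
        rw [mul_left_comm, ← h, ← mul_assoc, inv_mul_cancel₀ hna, one_mul]
  obtain ⟨n, hn⟩ := exists_nat_gt (-a)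
  exact hind n a (by linarith)

/-- Termwise integration of a series of exponentials along the Hankel contour. -/
lemma hasSum_hankelIntegral {θ : ℝ} (h0 : 0 ≤ θ) (h1 : θ ≤ π) (hθ : cos θ < 0) (L : ℝ)
    {c a : ℕ → ℝ} {S : ℝ → ℝ} {F : ℂ → ℂ}
    (hS : ∀ t, HasSum (fun n => |c n| * rexp (a n * max t L)) (S t))
    (hint : IntegrableOn
      (fun t => ‖Complex.exp (Complex.exp (hankelPoint L θ t))‖ * S t) (Ioi (L - θ)))
    (hF : ∀ t, HasSum (fun n => c n * Complex.exp (a n * hankelPoint L θ t))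
      (F (hankelPoint L θ t))) :
    HasSum (fun n => c n * (Real.Gamma (1 - a n))⁻¹) ((hankelIntegral L θ F).im / π) := by
  have hbd : ∀ t, HasSum (fun n => ‖Complex.exp (Complex.exp (hankelPoint L θ t))‖ *
      (|c n| * rexp (a n * max t L)))
      (‖Complex.exp (Complex.exp (hankelPoint L θ t))‖ * S t) := fun t => (hS t).mul_left _
  have key := hasSum_integral_of_dominated_convergence (μ := volume.restrict (Ioi (L - θ)))
    (F := fun n t => (c n : ℂ) * (hankelDir L t * (Complex.exp (Complex.exp (hankelPoint L θ t)) *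
      Complex.exp (a n * hankelPoint L θ t))))
    (f := fun t => hankelDir L t * (Complex.exp (Complex.exp (hankelPoint L θ t)) *
      F (hankelPoint L θ t)))
    (fun n t => ‖Complex.exp (Complex.exp (hankelPoint L θ t))‖ * (|c n| * rexp (a n * max t L)))
    (fun n => ((integrableOn_hankel_exp hθ L (a n)).const_mul _).aestronglyMeasurable)
    (fun n => Eventually.of_forall fun t => ?_)
    (Eventually.of_forall fun t => (hbd t).summable)
    (by simp only [(hbd _).tsum_eq]; exact hint)
    (Eventually.of_forall fun t => ?_)
  · have h := (Complex.hasSum_im key).div_const π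
    refine h.congr_fun fun n => ?_
    have := hankelIntegral_im h0 h1 hθ L (a n)
    rw [hankelIntegral] at this
    rw [integral_const_mul, Complex.im_ofReal_mul, this]
    field_simp
  · simp only [norm_mul, norm_hankelDir, norm_exp_mul_hankelPoint, Complex.norm_real, norm_eq_abs]
    exact le_of_eq (by ring)
  · have h := (hF t).mul_left (hankelDir L t * Complex.exp (Complex.exp (hankelPoint L θ t)))
    rw [mul_assoc] at h
    refine h.congr_fun fun n => ?_
    ring

lemma wright_neg_eq_hankelIntegral {θ ν : ℝ} (h0 : 0 ≤ θ) (h1 : θ ≤ π) (hθ : cos θ < 0)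
    (hν : ν < 1) (L μ r : ℝ) :
    wright (-ν) μ (-r) = (hankelIntegral L θ (fun z =>
      Complex.exp ((1 - μ : ℝ) * z) * Complex.exp (-r * Complex.exp (ν * z)))).im / π := by
  have h := hasSum_hankelIntegral h0 h1 hθ L (c := fun n => (-r) ^ n / (n.factorial : ℝ))
    (a := fun n => 1 - μ + ν * n)
    (S := fun t => rexp ((1 - μ) * max t L) * rexp (|r| * rexp (ν * max t L)))
    (F := fun z => Complex.exp ((1 - μ : ℝ) * z) * Complex.exp (-r * Complex.exp (ν * z)))
    (fun t => ?_) ?_ fun t => ?_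
  · rw [wright, ← h.tsum_eq]
    refine tsum_congr fun n => ?_
    rw [show 1 - (1 - μ + ν * n) = -ν * n + μ by ring, div_mul_eq_div_div, ← div_eq_mul_inv]
  · have h := (NormedSpace.expSeries_div_hasSum_exp (𝔸 := ℝ) (|r| * rexp (ν * max t L))).mul_left
      (rexp ((1 - μ) * max t L))
    rw [← Real.exp_eq_exp_ℝ] at h
    refine h.congr_fun fun n => ?_
    rw [abs_div, abs_pow, abs_neg, Nat.abs_cast, add_mul, exp_add, mul_pow, ← exp_nat_mul]
    ring_nf
  · refine (integrableOn_hankel_bound hθ hν L (1 - μ) |r|).congr_fun (fun t _ => ?_)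
      measurableSet_Ioi
    simp only [mul_assoc]
  · have h := (NormedSpace.expSeries_div_hasSum_exp (𝔸 := ℂ)
      (-r * Complex.exp (ν * hankelPoint L θ t))).mul_left
      (Complex.exp ((1 - μ : ℝ) * hankelPoint L θ t))
    rw [← Complex.exp_eq_exp_ℂ] at h
    refine h.congr_fun fun n => ?_
    push_cast
    rw [add_mul _ _ (hankelPoint L θ t), Complex.exp_add, mul_pow, ← Complex.exp_nat_mul]
    ring_nf

lemma mittagLeffler_neg_eq_hankelIntegral {θ ν s L : ℝ} (h0 : 0 ≤ θ) (h1 : θ ≤ π)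
    (hθ : cos θ < 0) (hν : 0 < ν) (hs : 0 < s) (hL : s * rexp (-ν * L) ≤ 1 / 2) (μ : ℝ) :
    mittagLeffler ν (μ + ν) (-s) = (hankelIntegral L θ (fun z =>
      Complex.exp ((1 - μ : ℝ) * z) * (s + Complex.exp (ν * z))⁻¹)).im / π := by
  have hq : ∀ t, s * rexp (-ν * max t L) ≤ 1 / 2 := fun t => by
    refine le_trans (mul_le_mul_of_nonneg_left (exp_le_exp.mpr ?_) hs.le) hL
    nlinarith [le_max_right t L]
  have hq0 : ∀ t, 0 < s * rexp (-ν * max t L) := fun t => by positivity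
  have h := hasSum_hankelIntegral h0 h1 hθ L (c := fun n => (-s) ^ n)
    (a := fun n => 1 - μ - ν - ν * n)
    (S := fun t => rexp ((1 - μ - ν) * max t L) * (1 - s * rexp (-ν * max t L))⁻¹)
    (F := fun z => Complex.exp ((1 - μ : ℝ) * z) * (s + Complex.exp (ν * z))⁻¹)
    (fun t => ?_) ?_ fun t => ?_
  · rw [mittagLeffler, ← h.tsum_eq]
    refine tsum_congr fun n => ?_
    rw [show 1 - (1 - μ - ν - ν * n) = ν * n + (μ + ν) by ring, ← div_eq_mul_inv]
  · have h := (hasSum_geometric_of_lt_one (hq0 t).le (by linarith [hq t])).mul_left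
      (rexp ((1 - μ - ν) * max t L))
    refine h.congr_fun fun n => ?_
    rw [abs_pow, abs_neg, abs_of_pos hs, sub_mul _ (ν * n), sub_eq_add_neg, exp_add, mul_pow,
      ← exp_nat_mul]
    ring_nf
  · have hc := continuous_hankelPoint L θ
    refine ((integrableOn_hankel_bound hθ (ν := 0) (by norm_num) L (1 - μ - ν) 0).const_mul
      2).mono' (Continuous.aestronglyMeasurable ?_) (Eventually.of_forall fun t => ?_)
    · have : Continuous fun t => (1 - s * rexp (-ν * max t L))⁻¹ :=
        Continuous.inv₀ (by fun_prop) fun t => by linarith [hq t]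
      fun_prop
    · have hi : (1 - s * rexp (-ν * max t L))⁻¹ ≤ 2 := by
        rw [inv_le_comm₀ (by linarith [hq t]) two_pos]
        linarith [hq t]
      have hi0 : 0 ≤ (1 - s * rexp (-ν * max t L))⁻¹ := inv_nonneg.mpr (by linarith [hq t])
      rw [norm_of_nonneg (by positivity), zero_mul, exp_zero, mul_one, ← mul_assoc,
        mul_comm (2 : ℝ)]
      exact mul_le_mul_of_nonneg_left hi (by positivity)
  · have hn : ‖-s * Complex.exp (-ν * hankelPoint L θ t)‖ < 1 := by
      have := norm_exp_mul_hankelPoint L θ (-ν) t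
      push_cast at this
      rw [norm_mul, this, norm_neg, Complex.norm_real, norm_of_nonneg hs.le]
      linarith [hq t]
    have h := (hasSum_geometric_of_norm_lt_one hn).mul_left
      (Complex.exp ((1 - μ - ν : ℝ) * hankelPoint L θ t))
    have e : Complex.exp ((1 - μ : ℝ) * hankelPoint L θ t) *
        (s + Complex.exp (ν * hankelPoint L θ t))⁻¹ =
        Complex.exp ((1 - μ - ν : ℝ) * hankelPoint L θ t) *
        (1 - -s * Complex.exp (-ν * hankelPoint L θ t))⁻¹ := by
      have e1 : (s : ℂ) + Complex.exp (ν * hankelPoint L θ t) =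
          Complex.exp (ν * hankelPoint L θ t) *
            (1 - -s * Complex.exp (-ν * hankelPoint L θ t)) := by
        have : Complex.exp (ν * hankelPoint L θ t) * Complex.exp (-ν * hankelPoint L θ t) = 1 := by
          rw [← Complex.exp_add]; simp
        linear_combination (-s : ℂ) * this
      rw [e1, mul_inv, ← mul_assoc, ← Complex.exp_neg, ← Complex.exp_add]
      push_cast
      ring_nf
    rw [e]
    refine h.congr_fun fun n => ?_
    push_cast
    rw [sub_mul _ (ν * n : ℂ), sub_eq_add_neg _ (ν * n * _ : ℂ), Complex.exp_add, mul_pow,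
      ← Complex.exp_nat_mul]
    ring_nf

lemma exp_hankelPoint_re_nonneg {θ ν : ℝ} (hν : 0 ≤ ν) (hνθ : ν * θ ≤ π / 2) {L t : ℝ}
    (ht : L - θ < t) (h0 : 0 ≤ θ) : 0 ≤ (Complex.exp (ν * hankelPoint L θ t)).re := by
  rw [Complex.exp_re, Complex.im_ofReal_mul, hankelPoint_im]
  refine mul_nonneg (exp_pos _).le (cos_nonneg_of_neg_pi_div_two_le_of_le ?_ ?_)
  · have : 0 ≤ min (t - L + θ) θ := le_min (by linarith) h0
    have := mul_nonneg hν this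
    linarith [pi_pos]
  · exact (mul_le_mul_of_nonneg_left (min_le_right _ _) hν).trans hνθ

/-- The Laplace transform may be taken under the Hankel integral. -/
lemma laplace_hankelIntegral {θ ν s : ℝ} (h0 : 0 ≤ θ) (hθ : cos θ < 0) (hν : 0 ≤ ν)
    (hνθ : ν * θ ≤ π / 2) (hs : 0 < s) (L a : ℝ) :
    IntegrableOn (fun r : ℝ => rexp (-s * r) * hankelIntegral L θ (fun z =>
      Complex.exp (a * z) * Complex.exp (-r * Complex.exp (ν * z)))) (Ioi 0) ∧
    ∫ r in Ioi (0 : ℝ), rexp (-s * r) * hankelIntegral L θ (fun z =>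
      Complex.exp (a * z) * Complex.exp (-r * Complex.exp (ν * z))) =
    hankelIntegral L θ (fun z => Complex.exp (a * z) * (s + Complex.exp (ν * z))⁻¹) := by
  have hc := continuous_hankelPoint L θ
  let Φ : ℝ → ℝ → ℂ := fun r t => hankelDir L t * (Complex.exp (Complex.exp (hankelPoint L θ t)) *
    (Complex.exp (a * hankelPoint L θ t) *
      Complex.exp (-(s + Complex.exp (ν * hankelPoint L θ t)) * r)))
  have hΦ : Integrable (Function.uncurry Φ)
      ((volume.restrict (Ioi 0)).prod (volume.restrict (Ioi (L - θ)))) := by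
    have hb := (integrableOn_exp_mul_Ioi (neg_lt_zero.mpr hs) 0).mul_prod
      (integrableOn_hankel_bound hθ (ν := 0) (by norm_num) L a 0)
    refine hb.mono' ?_ ?_
    · refine ((measurable_hankelDir L).comp measurable_snd).aestronglyMeasurable.mul
        (Continuous.aestronglyMeasurable ?_)
      fun_prop
    · rw [Measure.prod_restrict, ae_restrict_iff' (measurableSet_Ioi.prod measurableSet_Ioi)]
      refine Eventually.of_forall fun p hp => ?_
      have hre := exp_hankelPoint_re_nonneg hν hνθ hp.2 h0
      have hp1 : 0 < p.1 := hp.1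
      simp only [Function.uncurry, Φ, norm_mul, norm_hankelDir, norm_exp_mul_hankelPoint, one_mul,
        zero_mul, exp_zero, mul_one]
      have : ‖Complex.exp (-(s + Complex.exp (ν * hankelPoint L θ p.2)) * p.1)‖
          ≤ rexp (-s * p.1) := by
        rw [Complex.norm_exp, exp_le_exp, Complex.re_mul_ofReal, Complex.neg_re, Complex.add_re,
          Complex.ofReal_re]
        nlinarith
      calc _ = ‖Complex.exp (-(s + Complex.exp (ν * hankelPoint L θ p.2)) * p.1)‖ *
            (‖Complex.exp (Complex.exp (hankelPoint L θ p.2))‖ * rexp (a * max p.2 L)) := by ring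
        _ ≤ _ := mul_le_mul_of_nonneg_right this (by positivity)
  have hinner : ∀ r : ℝ, ∫ t in Ioi (L - θ), Φ r t = rexp (-s * r) * hankelIntegral L θ (fun z =>
      Complex.exp (a * z) * Complex.exp (-r * Complex.exp (ν * z))) := fun r => by
    rw [hankelIntegral, ← integral_const_mul]
    congr 1
    funext t
    simp only [Φ]
    rw [show -((s : ℂ) + Complex.exp (ν * hankelPoint L θ t)) * r =
      (-s * r : ℝ) + -r * Complex.exp (ν * hankelPoint L θ t) by push_cast; ring,
      Complex.exp_add, Complex.ofReal_exp]
    ring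
  simp only [← hinner]
  refine ⟨hΦ.integral_prod_left, ?_⟩
  rw [integral_integral_swap hΦ, hankelIntegral]
  refine setIntegral_congr_fun measurableSet_Ioi fun t ht => ?_
  have hre := exp_hankelPoint_re_nonneg hν hνθ ht h0
  simp only [Φ]
  rw [integral_const_mul, integral_const_mul, integral_const_mul,
    integral_exp_mul_complex_Ioi (by simpa using by linarith), Complex.ofReal_zero, mul_zero,
    Complex.exp_zero, neg_div_neg_eq, one_div]

theorem laplace_wright_second_kind (ν μ : ℝ) (hν0 : 0 < ν) (hν1 : ν < 1)
    (s : ℝ) (hs : 0 < s) :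
    MeasureTheory.IntegrableOn
      (fun r : ℝ => Real.exp (-s * r) * wright (-ν) μ (-r)) (Set.Ioi 0) ∧
    ∫ r in Set.Ioi (0 : ℝ), Real.exp (-s * r) * wright (-ν) μ (-r) =
      mittagLeffler ν (μ + ν) (-s) := by
  set θ : ℝ := min (3 / 2) ν⁻¹ * (π / 2) with hθdef
  have hp1 : 1 < min (3 / 2) ν⁻¹ := lt_min (by norm_num) ((one_lt_inv₀ hν0).mpr hν1)
  have hp2 : min (3 / 2) ν⁻¹ ≤ 3 / 2 := min_le_left _ _
  have hπ := pi_pos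
  have hθlow : π / 2 < θ := by nlinarith
  have hθπ : θ ≤ π := by nlinarith
  have hθ0 : 0 ≤ θ := by linarith
  have hcos : cos θ < 0 := cos_neg_of_pi_div_two_lt_of_lt hθlow (by linarith)
  have hνθ : ν * θ ≤ π / 2 := by
    have h := mul_le_mul_of_nonneg_left (min_le_right (3 / 2) ν⁻¹) hν0.le
    rw [mul_inv_cancel₀ hν0.ne'] at h
    rw [hθdef, ← mul_assoc]
    nlinarith
  set L : ℝ := log (2 * s) / ν with hLdef
  have hL : s * rexp (-ν * L) ≤ 1 / 2 := by
    rw [hLdef, neg_mul, mul_div_cancel₀ _ hν0.ne', exp_neg, exp_log (by positivity)]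
    field_simp
    rfl
  obtain ⟨hint, heq⟩ := laplace_hankelIntegral hθ0 hcos hν0.le hνθ hs L (1 - μ)
  have hfun : (fun r : ℝ => rexp (-s * r) * wright (-ν) μ (-r)) = fun r => (rexp (-s * r) *
      hankelIntegral L θ (fun z => Complex.exp ((1 - μ : ℝ) * z) *
        Complex.exp (-r * Complex.exp (ν * z)))).im / π := by
    funext r
    rw [wright_neg_eq_hankelIntegral hθ0 hθπ hcos hν1 L, Complex.im_ofReal_mul, mul_div_assoc]
  rw [hfun, mittagLeffler_neg_eq_hankelIntegral hθ0 hθπ hcos hν0 hs hL, ← heq]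
  refine ⟨hint.im.div_const π, ?_⟩
  rw [integral_div]
  congr 1
  exact Complex.imCLM.integral_comp_comm hint
end

section
/- For every z ∈ ℂ, M_{1/2}(z) = (1/√π)·e^{-z²/4}; that is, ∑_{n=0}^∞ (-z)^n/(n!·Γ(-n/2 + 1/2)) = (1/√π)·exp(-z²/4). -/
open scoped Real

theorem factorial_two_mul_mul_Gamma_half_sub (k : ℕ) :
    ((2 * k).factorial : ℝ) * Real.Gamma (1 / 2 - k) =
      √π * (-4) ^ k * (k.factorial : ℝ) := by
  induction k with
  | zero => simpa using Real.Gamma_one_half_eq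
  | succ k ih =>
    have hk : (-(1 / 2) - k : ℝ) ≠ 0 := by
      have : (0 : ℝ) ≤ k := k.cast_nonneg
      linarith
    have hrec := Real.Gamma_add_one hk
    rw [show (-(1 / 2) - k + 1 : ℝ) = 1 / 2 - k by ring] at hrec
    rw [hrec] at ih
    rw [show 2 * (k + 1) = 2 * k + 1 + 1 by ring, Nat.factorial_succ, Nat.factorial_succ,
      Nat.factorial_succ]
    push_cast
    rw [show (1 / 2 - (k + 1) : ℝ) = -(1 / 2) - k by ring]
    linear_combination (-4 * ((k : ℝ) + 1)) * ih

theorem mainardiM_half_term_even (z : ℂ) (k : ℕ) :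
    (-z) ^ (2 * k) / (((2 * k).factorial : ℂ) *
        Complex.Gamma (((-((2 * k : ℕ) : ℝ) / 2 + 1 / 2 : ℝ) : ℂ))) =
      (1 / (Real.sqrt π : ℂ)) * ((-z ^ 2 / 4) ^ k / (k.factorial : ℂ)) := by
  have h := congrArg (fun x : ℝ => (x : ℂ)) (factorial_two_mul_mul_Gamma_half_sub k)
  rw [show (-((2 * k : ℕ) : ℝ) / 2 + 1 / 2 : ℝ) = 1 / 2 - k by push_cast; ring,
    Complex.Gamma_ofReal]
  simp only [Complex.ofReal_mul, Complex.ofReal_natCast, Complex.ofReal_pow] at h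
  have h4 : (-z ^ 2 / 4) ^ k = (-z) ^ (2 * k) / (-4) ^ k := by
    rw [pow_mul, ← div_pow]
    congr 1
    ring
  rw [h, h4]
  push_cast
  rw [one_div, div_div, inv_mul_eq_div, div_div]
  congr 1
  ring

theorem mainardiM_half_term_odd (z : ℂ) (k : ℕ) :
    (-z) ^ (2 * k + 1) / (((2 * k + 1).factorial : ℂ) *
        Complex.Gamma (((-((2 * k + 1 : ℕ) : ℝ) / 2 + 1 / 2 : ℝ) : ℂ))) = 0 := by
  rw [show (-((2 * k + 1 : ℕ) : ℝ) / 2 + 1 / 2 : ℝ) = -k by push_cast; ring,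
    Complex.Gamma_ofReal, Real.Gamma_neg_nat_eq_zero]
  simp

theorem mainardiM_half (z : ℂ) :
    ∑' n : ℕ, (-z) ^ n /
        ((n.factorial : ℂ) * Complex.Gamma (((-(n : ℝ) / 2 + 1 / 2 : ℝ) : ℂ))) =
      (1 / (Real.sqrt π : ℂ)) * Complex.exp (-z ^ 2 / 4) := by
  have hexp : HasSum (fun k : ℕ => (-z ^ 2 / 4) ^ k / (k.factorial : ℂ))
      (Complex.exp (-z ^ 2 / 4)) := by
    rw [Complex.exp_eq_exp_ℂ]
    exact NormedSpace.expSeries_div_hasSum_exp _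
  have heven := hexp.mul_left (1 / (Real.sqrt π : ℂ))
  simp only [← mainardiM_half_term_even] at heven
  have hodd : HasSum (fun k : ℕ => (-z) ^ (2 * k + 1) / (((2 * k + 1).factorial : ℂ) *
      Complex.Gamma (((-((2 * k + 1 : ℕ) : ℝ) / 2 + 1 / 2 : ℝ) : ℂ)))) 0 := by
    simp only [mainardiM_half_term_odd]
    exact hasSum_zero
  have h := HasSum.even_add_odd (f := fun n : ℕ => (-z) ^ n /
    ((n.factorial : ℂ) * Complex.Gamma (((-(n : ℝ) / 2 + 1 / 2 : ℝ) : ℂ)))) heven hodd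
  rw [add_zero] at h
  exact h.tsum_eq
end
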